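/- arXiv:2605.18079 — 2 statements merged into one kernel-verified Lean document; each statement's English description precedes it below -/
import Mathlib

section
/- Let d ∈ ℕ, let I₁, I₂ be registers with |I₁| = |I₂| = d', let F₁,…,F_m be flags, all pairwise disjoint, let b*_1,…,b*_m ∈ {0,1} and let k ∈ {0,…,d'−1}. Then there exists an MLP f with input dimension d, hidden dimension 4d' and ternary weights such that for all x ∈ {−1,0,1}^d with x[F_j] ∈ {0,1} for all j: if x[I₁] = bin_{d'}(p) for some integer 0 ≤ p < 2^{d'} and x[F_j] = b*_j for all j, then f(x)[I₂] = bin_{d'}(min(2^{d'} − 1, p + 2^k)); if x[F_j] ≠ b*_j for some j, then f(x)[I₂] = 0; and all coordinates of f(x) at indices not in I₂ are always 0. -/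
/-- A single-hidden-layer ReLU MLP `x ↦ W₂ ReLU(W₁ x + b)` with input/output dimension `d`
and hidden dimension `dff`. -/
structure MLP (d dff : ℕ) where
  W1 : Matrix (Fin dff) (Fin d) ℝ
  b : Fin dff → ℝ
  W2 : Matrix (Fin d) (Fin dff) ℝ

/-- The hidden activations `ReLU(W₁ x + b)` of the MLP. -/
noncomputable def MLP.hidden {d dff : ℕ} (f : MLP d dff) (x : Fin d → ℝ) : Fin dff → ℝ :=
  fun h => max 0 (f.W1.mulVec x h + f.b h)

/-- The output `W₂ ReLU(W₁ x + b)` of the MLP. -/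
noncomputable def MLP.eval {d dff : ℕ} (f : MLP d dff) (x : Fin d → ℝ) : Fin d → ℝ :=
  f.W2.mulVec (f.hidden x)

/-- The MLP has ternary weights: all entries of `W₁` and `W₂` lie in `{-1,0,1}`. -/
def MLP.Ternary {d dff : ℕ} (f : MLP d dff) : Prop :=
  (∀ i j, f.W1 i j = -1 ∨ f.W1 i j = 0 ∨ f.W1 i j = 1) ∧
  (∀ i j, f.W2 i j = -1 ∨ f.W2 i j = 0 ∨ f.W2 i j = 1)

def IsTernary (a : ℝ) : Prop := a = -1 ∨ a = 0 ∨ a = 1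
def IsBit (a : ℝ) : Prop := a = 0 ∨ a = 1
def IsSign (a : ℝ) : Prop := a = -1 ∨ a = 1

/-- The ±1 binary representation of `i` with `r` bits, least significant bit first:
bit `s` is `1` if `⌊i / 2^s⌋` is odd and `-1` otherwise. -/
def binRep (r : ℕ) (i : ℕ) : Fin r → ℝ :=
  fun s => if (i / 2 ^ (s : ℕ)) % 2 = 1 then 1 else -1

theorem Nat.testBit_succ_of_trailing_ones (n u : ℕ) (hone : ∀ i < n, u.testBit i = true)
    (hzero : u.testBit n = false) (t : ℕ) :
    (u + 1).testBit t = if t = n then true else if t < n then false else u.testBit t := by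
  induction n generalizing u t with
  | zero =>
    rw [Nat.testBit_zero] at hzero
    have hu : u % 2 = 0 := by simpa using hzero
    cases t with
    | zero => simp [Nat.testBit_zero]; omega
    | succ t =>
      have h : (u + 1) / 2 = u / 2 := by omega
      simp [Nat.testBit_succ, h]
  | succ n ih =>
    have h0 := hone 0 (by omega)
    rw [Nat.testBit_zero] at h0
    have hu : u % 2 = 1 := by simpa using h0
    have hdiv : (u + 1) / 2 = u / 2 + 1 := by omega
    cases t with
    | zero => simp [Nat.testBit_zero]; omega
    | succ t =>
      rw [Nat.testBit_succ, hdiv, ih (u / 2) (fun i hi => by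
        rw [← Nat.testBit_succ]; exact hone _ (by omega)) (by rw [← Nat.testBit_succ]; exact hzero),
        Nat.testBit_succ]
      simp

theorem Nat.testBit_add_two_pow_of_lt (p k t : ℕ) (h : t < k) :
    (p + 2 ^ k).testBit t = p.testBit t := by
  rw [Nat.add_comm, Nat.testBit_two_pow_add_gt h]

theorem Nat.testBit_add_two_pow_of_le (p k t : ℕ) (h : k ≤ t) :
    (p + 2 ^ k).testBit t = (p / 2 ^ k + 1).testBit (t - k) := by
  rw [← Nat.add_div_right _ (Nat.two_pow_pos k), Nat.testBit_div_two_pow]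
  congr 1
  omega

/-- Adding `2 ^ k` flips the run of ones starting at position `k` and the first zero after it. -/
theorem Nat.testBit_add_two_pow_of_run (p k z : ℕ) (hkz : k ≤ z)
    (hone : ∀ i, k ≤ i → i < z → p.testBit i = true) (hzero : p.testBit z = false) (t : ℕ) :
    (p + 2 ^ k).testBit t =
      if t = z then true else if k ≤ t ∧ t < z then false else p.testBit t := by
  rcases lt_or_ge t k with h | h
  · rw [Nat.testBit_add_two_pow_of_lt _ _ _ h, if_neg (by omega), if_neg (by omega)]
  · rw [Nat.testBit_add_two_pow_of_le _ _ _ h,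
      Nat.testBit_succ_of_trailing_ones (z - k) (p / 2 ^ k)
        (fun i hi => by rw [Nat.testBit_div_two_pow]; exact hone _ (by omega) (by omega))
        (by rw [Nat.testBit_div_two_pow, Nat.sub_add_cancel hkz]; exact hzero),
      Nat.testBit_div_two_pow, Nat.sub_add_cancel h]
    have h1 : t - k = z - k ↔ t = z := by omega
    have h2 : t - k < z - k ↔ k ≤ t ∧ t < z := by omega
    simp only [h1, h2]

theorem Nat.add_two_pow_lt_of_testBit_eq_false {p r k z : ℕ} (hp : p < 2 ^ r) (hkz : k ≤ z)
    (hz : z < r) (hzero : p.testBit z = false) : p + 2 ^ k < 2 ^ r := by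
  have hr : 2 ^ r = 2 ^ k * 2 ^ (r - k) := by rw [← pow_add]; congr 1; omega
  have hu : p / 2 ^ k < 2 ^ (r - k) := Nat.div_lt_of_lt_mul (hr ▸ hp)
  have hne : p / 2 ^ k ≠ 2 ^ (r - k) - 1 := fun h => by
    have h1 : (p / 2 ^ k).testBit (z - k) = false := by
      rw [Nat.testBit_div_two_pow, Nat.sub_add_cancel hkz]; exact hzero
    rw [h, Nat.testBit_two_pow_sub_one] at h1
    have : ¬ (z - k < r - k) := by simpa using h1
    omega
  have h2 : (p + 2 ^ k) / 2 ^ k < 2 ^ (r - k) := by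
    rw [Nat.add_div_right _ (Nat.two_pow_pos k)]
    exact lt_of_le_of_ne hu fun h => hne (Nat.eq_sub_of_add_eq h)
  rw [hr, mul_comm]
  exact (Nat.div_lt_iff_lt_mul (Nat.two_pow_pos k)).1 h2

theorem Nat.two_pow_le_add_two_pow_of_testBit {p r k : ℕ} (hk : k ≤ r)
    (hone : ∀ i, k ≤ i → i < r → p.testBit i = true) : 2 ^ r ≤ p + 2 ^ k := by
  by_contra! h
  have hr : 2 ^ r = 2 ^ k * 2 ^ (r - k) := by rw [← pow_add]; congr 1; omega
  have hu : p / 2 ^ k < 2 ^ (r - k) :=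
    Nat.div_lt_of_lt_mul (hr ▸ (Nat.le_add_right p _).trans_lt h)
  have heq : p / 2 ^ k = 2 ^ (r - k) - 1 := by
    apply Nat.eq_of_testBit_eq
    intro i
    rw [Nat.testBit_two_pow_sub_one]
    rcases lt_or_ge i (r - k) with hi | hi
    · rw [Nat.testBit_div_two_pow, hone _ (by omega) (by omega)]; simp [hi]
    · rw [Nat.testBit_lt_two_pow (hu.trans_le (Nat.pow_le_pow_right (by omega) hi))]
      simp [hi]
  have h2 : (p + 2 ^ k) / 2 ^ k < 2 ^ (r - k) := Nat.div_lt_of_lt_mul (hr ▸ h)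
  rw [Nat.add_div_right _ (Nat.two_pow_pos k)] at h2
  omega

theorem binRep_eq_testBit (r i : ℕ) (s : Fin r) :
    binRep r i s = if i.testBit s = true then 1 else -1 := by
  simp [binRep, Nat.testBit_eq_decide_div_mod_eq]

theorem isSign_binRep (r i : ℕ) (s : Fin r) : IsSign (binRep r i s) := by
  unfold binRep IsSign
  split_ifs <;> simp

theorem IsTernary.mul_le_abs {a x : ℝ} (hx : IsTernary x) : a * x ≤ |a| := by
  rcases hx with rfl | rfl | rfl
  · simpa using neg_le_abs a
  · simp
  · simpa using le_abs_self a

/-- For ternary literals `a`, the indicator of the conjunction of `x s = a s` over the support of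
`a` is a single ReLU, which moreover vanishes as soon as its argument is lowered by at least `1`. -/
theorem conj_relu_eq_zero {ι : Type*} [Fintype ι] {a x : ι → ℝ} {M : ℝ}
    (hx : ∀ s, IsTernary (x s)) (hM : 1 ≤ M) :
    max 0 (∑ s, a s * x s + (1 - ∑ s, |a s|) - M) = 0 := by
  have h : ∑ s, a s * x s ≤ ∑ s, |a s| := Finset.sum_le_sum fun s _ => (hx s).mul_le_abs
  exact max_eq_left (by linarith)

theorem conj_relu_eq_indicator {ι : Type*} [Fintype ι] {a x : ι → ℝ}
    [Decidable (∀ s, a s ≠ 0 → x s = a s)]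
    (ha : ∀ s, IsTernary (a s)) (hx : ∀ s, IsSign (x s)) :
    max 0 (∑ s, a s * x s + (1 - ∑ s, |a s|)) = if ∀ s, a s ≠ 0 → x s = a s then 1 else 0 := by
  split_ifs with h
  · have h1 : ∑ s, a s * x s = ∑ s, |a s| := Finset.sum_congr rfl fun s _ => by
      rcases ha s with h' | h' | h'
      · rw [h s (by rw [h']; norm_num), h']; norm_num
      · simp [h']
      · rw [h s (by rw [h']; norm_num), h']; norm_num
    rw [h1]; norm_num
  · push Not at h
    obtain ⟨s, hs0, hs⟩ := h
    have h1 : ∑ s, (|a s| - a s * x s) ≥ |a s| - a s * x s :=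
      Finset.single_le_sum (f := fun s => |a s| - a s * x s)
        (fun i _ => sub_nonneg.2 (IsTernary.mul_le_abs ((hx i).imp id Or.inr))) (Finset.mem_univ s)
    rw [Finset.sum_sub_distrib] at h1
    have h2 : |a s| - a s * x s = 2 := by
      rcases ha s with h' | h' | h' <;> rcases hx s with h'' | h'' <;>
        simp only [h', h'', ne_eq, not_true_eq_false] at hs0 hs ⊢ <;> norm_num
    exact max_eq_left (by linarith)

theorem sum_extend_mul {ι κ : Type*} [Fintype ι] [Fintype κ] {g : ι → κ}
    (hg : Function.Injective g) (w : ι → ℝ) (x : κ → ℝ) :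
    ∑ i, Function.extend g w 0 i * x i = ∑ z, w z * x (g z) := by
  classical
  rw [← Finset.sum_subset (Finset.subset_univ (Finset.univ.map ⟨g, hg⟩)), Finset.sum_map]
  · simp [hg.extend_apply]
  · intro i _ hi
    rw [Function.extend_apply' _ _ _ (by simpa using hi)]
    simp

theorem extend_isTernary {ι κ : Type*} {g : ι → κ} (hg : Function.Injective g) {w : ι → ℝ}
    (hw : ∀ z, IsTernary (w z)) (i : κ) : IsTernary (Function.extend g w 0 i) := by
  by_cases h : ∃ z, g z = i
  · obtain ⟨z, rfl⟩ := h
    rw [hg.extend_apply]; exact hw z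
  · rw [Function.extend_apply' _ _ _ h]; exact Or.inr (Or.inl rfl)

namespace AddPow2

/-- Coefficient of a flag with target `b` in the number of mismatched flags. -/
noncomputable def flagSign (b : ℝ) : ℝ := if b = 0 then 1 else -1

theorem isTernary_neg_flagSign (b : ℝ) : IsTernary (-flagSign b) := by
  unfold flagSign IsTernary
  split_ifs <;> norm_num

/-- The number of mismatched flags. -/
noncomputable def mismatch {m : ℕ} (bstar y : Fin m → ℝ) : ℝ :=
  ∑ j, (flagSign (bstar j) * y j + bstar j)

theorem flagSign_mul_add {b y : ℝ} (hb : IsBit b) (hy : IsBit y) :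
    flagSign b * y + b = if y = b then 0 else 1 := by
  rcases hb with rfl | rfl <;> rcases hy with rfl | rfl <;> norm_num [flagSign]

theorem mismatch_eq_zero {m : ℕ} {bstar y : Fin m → ℝ} (hb : ∀ j, IsBit (bstar j))
    (h : ∀ j, y j = bstar j) : mismatch bstar y = 0 :=
  Finset.sum_eq_zero fun j _ => by
    rw [flagSign_mul_add (hb j) (h j ▸ hb j), if_pos (h j)]

theorem one_le_mismatch {m : ℕ} {bstar y : Fin m → ℝ} (hb : ∀ j, IsBit (bstar j))
    (hy : ∀ j, IsBit (y j)) (h : ∃ j, y j ≠ bstar j) : 1 ≤ mismatch bstar y := by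
  obtain ⟨j, hj⟩ := h
  have h1 := Finset.single_le_sum (f := fun j => flagSign (bstar j) * y j + bstar j)
    (fun i _ => by
      simp only [flagSign_mul_add (hb i) (hy i)]
      split_ifs <;> norm_num) (Finset.mem_univ j)
  simp only [flagSign_mul_add (hb j) (hy j), if_neg hj] at h1
  exact h1

/-- Literals of the neuron detecting that position `s ≥ k` is the first zero at or above `k`, or,
for `s < k`, that `s` is a zero while all positions from `k` on are ones. -/
noncomputable def carryLit {r : ℕ} (k : ℕ) (s i : Fin r) : ℝ :=
  if i = s then -1 else if k ≤ (i : ℕ) ∧ ((i : ℕ) < s ∨ (s : ℕ) < k) then 1 else 0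

/-- Literals of the four neurons attached to the position `s`. -/
noncomputable def lit {r : ℕ} (k : ℕ) : Fin 4 × Fin r → Fin r → ℝ
  | (0, s) => fun i => if i = s then 1 else 0
  | (1, s) => fun i => if i = s then -1 else 0
  | (_, s) => carryLit k s

/-- Weight of the carry neuron of position `s` in the output at position `t`. -/
noncomputable def carryOut {r : ℕ} (k : ℕ) (t s : Fin r) : ℝ :=
  if s = t then 1 else if k ≤ (t : ℕ) ∧ t < s then -1 else 0

/-- Output weights at position `t`. -/
noncomputable def out {r : ℕ} (k : ℕ) (t : Fin r) : Fin 4 × Fin r → ℝ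
  | (0, s) => if s = t then 1 else 0
  | (1, s) => if s = t then -1 else 0
  | (_, s) => carryOut k t s

theorem isTernary_carryLit {r : ℕ} (k : ℕ) (s i : Fin r) : IsTernary (carryLit k s i) := by
  unfold carryLit IsTernary
  split_ifs <;> norm_num

theorem isTernary_lit {r : ℕ} (k : ℕ) (h : Fin 4 × Fin r) (i : Fin r) :
    IsTernary (lit k h i) := by
  match h with
  | (0, s) => simp only [lit, IsTernary]; split_ifs <;> norm_num
  | (1, s) => simp only [lit, IsTernary]; split_ifs <;> norm_num
  | (2, s) => exact isTernary_carryLit k s i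
  | (3, s) => exact isTernary_carryLit k s i

theorem isTernary_out {r : ℕ} (k : ℕ) (t : Fin r) (h : Fin 4 × Fin r) :
    IsTernary (out k t h) := by
  match h with
  | (0, s) => simp only [out, IsTernary]; split_ifs <;> norm_num
  | (1, s) => simp only [out, IsTernary]; split_ifs <;> norm_num
  | (2, s) => simp only [out, carryOut, IsTernary]; split_ifs <;> norm_num
  | (3, s) => simp only [out, carryOut, IsTernary]; split_ifs <;> norm_num

/-- The network: hidden neurons are conjunctions of literals gated by the flags. -/
noncomputable def net {d r m : ℕ} (I1 I2 : Fin r → Fin d) (Fl : Fin m → Fin d)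
    (bstar : Fin m → ℝ) (k : ℕ) : MLP d (4 * r) where
  W1 h := Function.extend (Sum.elim I1 Fl)
    (Sum.elim (lit k (finProdFinEquiv.symm h)) fun j => -flagSign (bstar j)) 0
  b h := (1 - ∑ i, |lit k (finProdFinEquiv.symm h) i|) - ∑ j, bstar j
  W2 i h := Function.extend I2 (fun t => out k t (finProdFinEquiv.symm h)) 0 i

section

variable {d r m : ℕ} {I1 I2 : Fin r → Fin d} {Fl : Fin m → Fin d} (bstar : Fin m → ℝ) (k : ℕ)

theorem net_ternary (h1 : Function.Injective (Sum.elim I1 Fl)) (h2 : Function.Injective I2) :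
    (net I1 I2 Fl bstar k).Ternary := by
  refine ⟨fun h i => extend_isTernary h1 ?_ i,
    fun i h => extend_isTernary h2 (fun t => isTernary_out k t (finProdFinEquiv.symm h)) i⟩
  rintro (s | j)
  · exact isTernary_lit k _ s
  · exact isTernary_neg_flagSign _

theorem net_hidden (h1 : Function.Injective (Sum.elim I1 Fl)) (x : Fin d → ℝ)
    (h : Fin 4 × Fin r) :
    (net I1 I2 Fl bstar k).hidden x (finProdFinEquiv h) =
      max 0 (∑ i, lit k h i * x (I1 i) + (1 - ∑ i, |lit k h i|) -
        mismatch bstar fun j => x (Fl j)) := by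
  simp only [MLP.hidden, net, Matrix.mulVec, dotProduct]
  rw [sum_extend_mul h1, Fintype.sum_sum_type]
  simp only [Equiv.symm_apply_apply, Sum.elim_inl, Sum.elim_inr, mismatch,
    Finset.sum_add_distrib, neg_mul, Finset.sum_neg_distrib]
  congr 1
  ring

theorem net_eval (h2 : Function.Injective I2) (x : Fin d → ℝ) (t : Fin r) :
    (net I1 I2 Fl bstar k).eval x (I2 t) =
      ∑ h, out k t h * (net I1 I2 Fl bstar k).hidden x (finProdFinEquiv h) := by
  simp only [MLP.eval, Matrix.mulVec, dotProduct]
  rw [← finProdFinEquiv.sum_comp]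
  simp only [net, h2.extend_apply, Equiv.symm_apply_apply]

theorem net_eval_of_notMem (x : Fin d → ℝ) {i : Fin d} (hi : i ∉ Set.range I2) :
    (net I1 I2 Fl bstar k).eval x i = 0 := by
  simp only [MLP.eval, Matrix.mulVec, dotProduct]
  refine Finset.sum_eq_zero fun h _ => ?_
  simp only [net]
  rw [Function.extend_apply' _ _ _ (by simpa using hi)]
  simp

end

open Classical in
/-- Indicator that all literals in the support of `a` hold in the binary representation of `p`. -/
noncomputable def conj {r : ℕ} (p : ℕ) (a : Fin r → ℝ) : ℝ :=
  if ∀ i, a i ≠ 0 → binRep r p i = a i then 1 else 0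

theorem sum_out_mul {r : ℕ} (k : ℕ) (t : Fin r) (v : Fin 4 × Fin r → ℝ) :
    ∑ h, out k t h * v h = v (0, t) - v (1, t) + ∑ s, carryOut k t s * v (2, s) +
      ∑ s, carryOut k t s * v (3, s) := by
  rw [Fintype.sum_prod_type, Fin.sum_univ_four]
  simp [out, sub_eq_add_neg]

theorem conj_single_sub {r : ℕ} (k p : ℕ) (t : Fin r) :
    conj p (lit k (0, t)) - conj p (lit k (1, t)) = binRep r p t := by
  simp only [conj, lit, binRep_eq_testBit]
  by_cases h : p.testBit t = true <;> simp [h] <;> norm_num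

theorem conj_carryLit {r : ℕ} (k p : ℕ) (s : Fin r) :
    conj p (carryLit k s) = if p.testBit s = false ∧
      ∀ i : ℕ, i < r → k ≤ i → i < s ∨ (s : ℕ) < k → p.testBit i = true then 1 else 0 := by
  unfold conj
  congr 1
  simp only [carryLit, binRep_eq_testBit, eq_iff_iff]
  constructor
  · intro h
    have hs : p.testBit s = false := by
      have := h s
      by_contra hc
      norm_num [hc] at this
    refine ⟨hs, fun i hi hki his => ?_⟩
    have := h ⟨i, hi⟩
    by_cases hc : i = s
    · omega
    · have hc' : (⟨i, hi⟩ : Fin r) ≠ s := fun e => hc (by rw [← e])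
      by_contra hb
      norm_num [hc', hki, his, hb] at this
  · rintro ⟨hs, hi⟩ i h0
    by_cases hc : i = s
    · subst hc; simp [hs]
    · rw [if_neg hc] at h0 ⊢
      by_cases h1 : k ≤ (i : ℕ) ∧ ((i : ℕ) < s ∨ (s : ℕ) < k)
      · rw [if_pos h1, if_pos (hi i i.2 h1.1 h1.2)]
      · exact absurd (if_neg h1) h0

theorem binRep_add_two_mul_sum {r k p : ℕ} (hk : k < r) (hp : p < 2 ^ r) (t : Fin r) :
    binRep r p t + 2 * ∑ s, carryOut k t s * conj p (carryLit k s) =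
      binRep r (min (2 ^ r - 1) (p + 2 ^ k)) t := by
  by_cases hex : ∃ z, k ≤ z ∧ z < r ∧ p.testBit z = false
  · classical
    obtain ⟨hkz, hzr, hz0⟩ := Nat.find_spec hex
    have hmin := fun i => Nat.find_min hex (m := i)
    generalize Nat.find hex = z at hkz hzr hz0 hmin
    have hone : ∀ i, k ≤ i → i < z → p.testBit i = true := fun i hi hiz => by
      have := hmin i hiz
      simpa [hi, hiz.trans hzr] using this
    have hconj : ∀ s : Fin r, conj p (carryLit k s) = if s = ⟨z, hzr⟩ then 1 else 0 := by
      intro s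
      rw [conj_carryLit]
      congr 1
      rw [eq_iff_iff, Fin.ext_iff]
      constructor
      · rintro ⟨hs, hi⟩
        by_contra hne
        by_cases hsz : k ≤ (s : ℕ) ∧ (s : ℕ) < z
        · simp [hone s hsz.1 hsz.2] at hs
        · have : z < (s : ℕ) ∨ (s : ℕ) < k := by simp only at hne; omega
          simp [hi z hzr hkz this] at hz0
      · intro hs
        simp only at hs
        rw [hs]
        exact ⟨hz0, fun i _ hki hi => hone i hki (by omega)⟩
    simp only [hconj, mul_ite, mul_one, mul_zero, Finset.sum_ite_eq', Finset.mem_univ, if_true]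
    have hlt := Nat.add_two_pow_lt_of_testBit_eq_false hp hkz hzr hz0
    rw [min_eq_right (by omega), binRep_eq_testBit, binRep_eq_testBit,
      Nat.testBit_add_two_pow_of_run p k z hkz hone hz0]
    simp only [carryOut, Fin.ext_iff, Fin.lt_def]
    by_cases htz : (t : ℕ) = z
    · simp [htz, hz0]; norm_num
    · by_cases hkt : k ≤ (t : ℕ) ∧ (t : ℕ) < z
      · simp [htz, Ne.symm htz, hkt, hone t hkt.1 hkt.2]; norm_num
      · simp [htz, Ne.symm htz, hkt]
  · push Not at hex
    have hone : ∀ i, k ≤ i → i < r → p.testBit i = true := fun i h1 h2 => by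
      simpa using hex i h1 h2
    rw [min_eq_left (by have := Nat.two_pow_le_add_two_pow_of_testBit hk.le hone; omega),
      Finset.sum_eq_single t]
    · rw [conj_carryLit, binRep_eq_testBit, binRep_eq_testBit, Nat.testBit_two_pow_sub_one]
      have hi : ∀ i : ℕ, i < r → k ≤ i → i < t ∨ (t : ℕ) < k → p.testBit i = true :=
        fun i h1 h2 _ => hone i h2 h1
      by_cases ht : p.testBit t = true
      · simp [ht]
      · simp only [ht, carryOut]
        simp [and_iff_left hi]; norm_num
    · intro s _ hst
      unfold carryOut
      rw [if_neg hst]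
      split_ifs with h
      · have h2 := Fin.lt_def.1 h.2
        rw [conj_carryLit, if_neg (by simp [hone s (by omega) s.2])]
        simp
      · simp
    · simp

end AddPow2

/-- Power-of-2 addition lemma: there is a ternary MLP with hidden dimension `4d'`
which, on admissible ternary inputs with binary flag values, writes
`bin_{d'}(min(2^{d'} − 1, p + 2^k))` to the register `I₂` whenever `I₁` holds
`bin_{d'}(p)` and all flags match the target bits; writes `0` to `I₂` when some flag
does not match; and always outputs `0` outside `I₂`. -/
theorem add_pow2_mlp (d d' m : ℕ) (I1 I2 : Fin d' → Fin d) (Fl : Fin m → Fin d)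
    (hdisj : Function.Injective (Sum.elim (Sum.elim I1 I2) Fl))
    (bstar : Fin m → ℝ) (hbstar : ∀ j, IsBit (bstar j))
    (k : ℕ) (hk : k < d') :
    ∃ f : MLP d (4 * d'), f.Ternary ∧
      ∀ x : Fin d → ℝ, (∀ i, IsTernary (x i)) → (∀ j, IsBit (x (Fl j))) →
        (∀ p : ℕ, p < 2 ^ d' → (∀ t, x (I1 t) = binRep d' p t) →
          (∀ j, x (Fl j) = bstar j) →
          ∀ t, f.eval x (I2 t) = binRep d' (min (2 ^ d' - 1) (p + 2 ^ k)) t) ∧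
        ((∃ j, x (Fl j) ≠ bstar j) → ∀ t, f.eval x (I2 t) = 0) ∧
        (∀ i, i ∉ Set.range I2 → f.eval x i = 0) := by
  have h1 : Function.Injective (Sum.elim I1 Fl) := by
    have := hdisj.comp (Function.Injective.sumMap Sum.inl_injective Function.injective_id :
      Function.Injective (Sum.map (Sum.inl : Fin d' → Fin d' ⊕ Fin d') (id : Fin m → Fin m)))
    rwa [Sum.elim_comp_map, Sum.elim_comp_inl, Function.comp_id] at this
  have h2 : Function.Injective I2 :=
    hdisj.comp (Sum.inl_injective.comp Sum.inr_injective)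
  refine ⟨AddPow2.net I1 I2 Fl bstar k, AddPow2.net_ternary bstar k h1 h2,
    fun x hx hF => ⟨fun p hp hI hfl t => ?_, fun hne t => ?_,
      fun i hi => AddPow2.net_eval_of_notMem bstar k x hi⟩⟩
  · have hhid : ∀ h, (AddPow2.net I1 I2 Fl bstar k).hidden x (finProdFinEquiv h) =
        AddPow2.conj p (AddPow2.lit k h) := fun h => by
      rw [AddPow2.net_hidden bstar k h1, AddPow2.mismatch_eq_zero hbstar hfl, sub_zero]
      simp only [hI, AddPow2.conj]
      exact conj_relu_eq_indicator (AddPow2.isTernary_lit k h) (isSign_binRep d' p)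
    rw [AddPow2.net_eval bstar k h2]
    simp only [hhid]
    rw [AddPow2.sum_out_mul, AddPow2.conj_single_sub, ← AddPow2.binRep_add_two_mul_sum hk hp,
      two_mul, ← add_assoc]
    rfl
  · rw [AddPow2.net_eval bstar k h2]
    refine Finset.sum_eq_zero fun h _ => ?_
    rw [AddPow2.net_hidden bstar k h1,
      conj_relu_eq_zero (fun s => hx (I1 s)) (AddPow2.one_le_mismatch hbstar hF hne), mul_zero]
end

section
/- Let n, d_v ∈ ℕ and M, L_V, Δ_s, Δ_v, δ ≥ 0. Let s = (s_0,…,s_{n−1}) ∈ ℝ^n with J = {j : s_j = max_l s_l} and separation β = sep(s), and let v_0,…,v_{n−1} ∈ ℝ^{d_v} with ‖v_j‖_∞ ≤ L_V·M for all j and v_j = v_{j'} for all j, j' ∈ J (tie-invariant values). Let α = hardmax(s) and o = Σ_j α_j v_j. Let s̃ ∈ ℝ^n with |s̃_j − s_j| ≤ Δ_s for all j, let ᾱ = softmax(s̃), let α̃ ∈ ℝ^n with Σ_j |α̃_j − ᾱ_j| ≤ δ, and let ṽ_0,…,ṽ_{n−1} ∈ ℝ^{d_v} with ‖ṽ_j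 − v_j‖_∞ ≤ Δ_v for all j. Then ‖Σ_j α̃_j ṽ_j − o‖_∞ ≤ (1 + δ)·Δ_v + (2n·e^{−(β − 2Δ_s)} + δ)·L_V·M. -/
open Classical

/-- The softmax of a vector of scores. -/
noncomputable def softmax {n : ℕ} (s : Fin n → ℝ) : Fin n → ℝ :=
  fun j => Real.exp (s j) / ∑ l, Real.exp (s l)

/-- The set of indices attaining the maximal score. -/
def argmaxSet {n : ℕ} (s : Fin n → ℝ) : Set (Fin n) := {j | ∀ l, s l ≤ s j}

/-- The (averaging) hardmax of a vector of scores: uniform weight on the maximizers. -/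
noncomputable def hardmax {n : ℕ} (s : Fin n → ℝ) : Fin n → ℝ :=
  fun j => if j ∈ argmaxSet s then 1 / ((argmaxSet s).ncard : ℝ) else 0

/-- The separation of the scores (meaningful when the complement of the argmax set is
nonempty; when empty the separation is `+∞`). -/
noncomputable def sepScore {n : ℕ} (s : Fin n → ℝ) : ℝ :=
  sInf (s '' argmaxSet s) - sSup (s '' (argmaxSet s)ᶜ)

theorem softmax_nonneg {n : ℕ} (s : Fin n → ℝ) (j : Fin n) : 0 ≤ softmax s j := by
  unfold softmax
  positivity

theorem sum_softmax {n : ℕ} [NeZero n] (s : Fin n → ℝ) : ∑ j, softmax s j = 1 := by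
  have hpos : 0 < ∑ l, Real.exp (s l) :=
    Finset.sum_pos (fun l _ => Real.exp_pos _) Finset.univ_nonempty
  unfold softmax
  rw [← Finset.sum_div, div_self hpos.ne']

theorem softmax_le_exp_sub {n : ℕ} (s : Fin n → ℝ) (j m : Fin n) :
    softmax s j ≤ Real.exp (s j - s m) := by
  rw [Real.exp_sub]
  exact div_le_div_of_nonneg_left (Real.exp_pos _).le (Real.exp_pos _)
    (Finset.single_le_sum (f := fun l => Real.exp (s l)) (fun l _ => (Real.exp_pos _).le)
      (Finset.mem_univ m))

theorem argmaxSet_nonempty {n : ℕ} [NeZero n] (s : Fin n → ℝ) : (argmaxSet s).Nonempty :=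
  Finite.exists_max s

theorem sum_hardmax {n : ℕ} [NeZero n] (s : Fin n → ℝ) : ∑ j, hardmax s j = 1 := by
  have hcard : ((argmaxSet s).ncard : ℝ) ≠ 0 :=
    Nat.cast_ne_zero.mpr (argmaxSet_nonempty s).ncard_pos.ne'
  have hfilter : (Finset.univ.filter (· ∈ argmaxSet s)).card = (argmaxSet s).ncard := by
    rw [← Set.ncard_coe_finset]
    simp
  unfold hardmax
  rw [← Finset.sum_filter, Finset.sum_const, hfilter, nsmul_eq_mul, mul_one_div, div_self hcard]

/-- Averaging a function that is constant on the maximizers with the hardmax weights. -/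
theorem sum_hardmax_mul {n : ℕ} [NeZero n] (s f : Fin n → ℝ) (c : ℝ)
    (hf : ∀ j ∈ argmaxSet s, f j = c) : ∑ j, hardmax s j * f j = c := by
  have h : ∀ j, hardmax s j * f j = hardmax s j * c := by
    intro j
    by_cases hj : j ∈ argmaxSet s
    · rw [hf j hj]
    · simp [hardmax, hj]
  simp_rw [h]
  rw [← Finset.sum_mul, sum_hardmax, one_mul]

theorem sepScore_le_sub {n : ℕ} (s : Fin n → ℝ) {m j : Fin n} (hm : m ∈ argmaxSet s)
    (hj : j ∉ argmaxSet s) : sepScore s ≤ s m - s j :=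
  sub_le_sub (csInf_le (Set.toFinite _).bddBelow (Set.mem_image_of_mem s hm))
    (le_csSup (Set.toFinite _).bddAbove (Set.mem_image_of_mem s hj))

/-- The softmax weight of perturbed scores on a non-maximizer decays with the separation. -/
theorem softmax_le_exp_neg_sepScore {n : ℕ} [NeZero n] {s st : Fin n → ℝ} {Δs : ℝ}
    (hst : ∀ j, |st j - s j| ≤ Δs) {j : Fin n} (hj : j ∉ argmaxSet s) :
    softmax st j ≤ Real.exp (-(sepScore s - 2 * Δs)) := by
  obtain ⟨m, hm⟩ := argmaxSet_nonempty s
  refine (softmax_le_exp_sub st j m).trans (Real.exp_le_exp.mpr ?_)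
  have hsep := sepScore_le_sub s hm hj
  have hj' := abs_le.mp (hst j)
  have hm' := abs_le.mp (hst m)
  linarith [hj'.2, hm'.1]

theorem abs_sum_mul_le {ι : Type*} (t : Finset ι) (a b : ι → ℝ) {A B : ℝ} (hB : 0 ≤ B)
    (ha : ∑ j ∈ t, |a j| ≤ A) (hb : ∀ j ∈ t, |b j| ≤ B) : |∑ j ∈ t, a j * b j| ≤ A * B :=
  calc |∑ j ∈ t, a j * b j| ≤ ∑ j ∈ t, |a j| * B :=
        (Finset.abs_sum_le_sum_abs _ _).trans (Finset.sum_le_sum fun j hj => by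
          rw [abs_mul]
          exact mul_le_mul_of_nonneg_left (hb j hj) (abs_nonneg _))
    _ = (∑ j ∈ t, |a j|) * B := (Finset.sum_mul _ _ _).symm
    _ ≤ A * B := mul_le_mul_of_nonneg_right ha hB

/-- The softmax average of a bounded function that is constant on the maximizers of the
unperturbed scores is close to that constant. -/
theorem abs_sum_softmax_mul_sub_le {n : ℕ} [NeZero n] {s st f : Fin n → ℝ} {Δs B c : ℝ}
    (hst : ∀ j, |st j - s j| ≤ Δs) (hB : 0 ≤ B) (hf : ∀ j ∈ argmaxSet s, f j = c)
    (hfB : ∀ j, |f j| ≤ B) :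
    |∑ j, softmax st j * (f j - c)| ≤
      (if ((argmaxSet s)ᶜ : Set (Fin n)).Nonempty
        then 2 * (n : ℝ) * Real.exp (-(sepScore s - 2 * Δs)) else 0) * B := by
  split_ifs with hne
  · have hcB : |c| ≤ B := by
      obtain ⟨m, hm⟩ := argmaxSet_nonempty s
      exact hf m hm ▸ hfB m
    have hterm : ∀ j, |softmax st j * (f j - c)| ≤
        Real.exp (-(sepScore s - 2 * Δs)) * (2 * B) := by
      intro j
      by_cases hj : j ∈ argmaxSet s
      · rw [hf j hj, sub_self, mul_zero, abs_zero]
        positivity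
      · rw [abs_mul, abs_of_nonneg (softmax_nonneg st j)]
        refine mul_le_mul (softmax_le_exp_neg_sepScore hst hj) ?_ (abs_nonneg _)
          (Real.exp_pos _).le
        linarith [abs_sub (f j) c, hfB j]
    calc |∑ j, softmax st j * (f j - c)|
        ≤ ∑ _j : Fin n, Real.exp (-(sepScore s - 2 * Δs)) * (2 * B) :=
          (Finset.abs_sum_le_sum_abs _ _).trans (Finset.sum_le_sum fun j _ => hterm j)
      _ = 2 * (n : ℝ) * Real.exp (-(sepScore s - 2 * Δs)) * B := by
          rw [Finset.sum_const, Finset.card_univ, Fintype.card_fin, nsmul_eq_mul]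
          ring
  · have hall : ∀ j, j ∈ argmaxSet s := by
      intro j
      by_contra hj
      exact hne ⟨j, hj⟩
    simp [fun j => hf j (hall j)]

/-- Attention head output error: for scores `s` with tie-invariant values `v` bounded by
`L_V·M`, perturbed scores `s̃` within `Δ_s`, attention weights `α̃` within total
distance `δ` of `softmax(s̃)`, and perturbed values `ṽ` within `Δ_v`, the perturbed head
output deviates from the hardmax head output `o = Σ_j hardmax(s)_j v_j` by at most
`(1 + δ)·Δ_v + (2n·e^{−(β − 2Δ_s)} + δ)·L_V·M` in each coordinate, where `β = sep(s)`
(when the complement of the argmax set is empty, `β = +∞` and the exponential term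
vanishes). -/
theorem head_output_error (n dv : ℕ) (M LV Δs Δv δ : ℝ)
    (hM : 0 ≤ M) (hLV : 0 ≤ LV) (hΔs : 0 ≤ Δs) (hΔv : 0 ≤ Δv) (hδ : 0 ≤ δ)
    (s : Fin n → ℝ) (v : Fin n → Fin dv → ℝ)
    (hv : ∀ j i, |v j i| ≤ LV * M)
    (htie : ∀ j j', j ∈ argmaxSet s → j' ∈ argmaxSet s → v j = v j')
    (st : Fin n → ℝ) (hst : ∀ j, |st j - s j| ≤ Δs)
    (alphat : Fin n → ℝ) (halphat : ∑ j, |alphat j - softmax st j| ≤ δ)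
    (vt : Fin n → Fin dv → ℝ) (hvt : ∀ j i, |vt j i - v j i| ≤ Δv) :
    ∀ i, |∑ j, alphat j * vt j i - ∑ j, hardmax s j * v j i| ≤
      (1 + δ) * Δv +
      ((if ((argmaxSet s)ᶜ : Set (Fin n)).Nonempty
        then 2 * (n : ℝ) * Real.exp (-(sepScore s - 2 * Δs))
        else 0) + δ) * (LV * M) := by
  intro i
  have hB : 0 ≤ LV * M := mul_nonneg hLV hM
  rcases Nat.eq_zero_or_pos n with rfl | hn
  · simp only [Finset.univ_eq_empty, Finset.sum_empty, sub_zero, abs_zero]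
    split_ifs <;> positivity
  · have : NeZero n := ⟨hn.ne'⟩
    obtain ⟨m, hm⟩ := argmaxSet_nonempty s
    have hf : ∀ j ∈ argmaxSet s, v j i = v m i := fun j hj => congrFun (htie j m hj hm) i
    have hweights : ∑ j, |alphat j| ≤ 1 + δ :=
      calc ∑ j, |alphat j| ≤ ∑ j, (softmax st j + |alphat j - softmax st j|) :=
            Finset.sum_le_sum fun j _ => by
              have h := abs_add_le (softmax st j) (alphat j - softmax st j)
              rwa [add_sub_cancel, abs_of_nonneg (softmax_nonneg st j)] at h
        _ ≤ 1 + δ := by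
            rw [Finset.sum_add_distrib, sum_softmax]
            linarith
    have hvalue := abs_sum_mul_le Finset.univ alphat (fun j => vt j i - v j i) hΔv hweights
      fun j _ => hvt j i
    have hweight := abs_sum_mul_le Finset.univ (fun j => alphat j - softmax st j)
      (fun j => v j i) hB halphat fun j _ => hv j i
    have hscore := abs_sum_softmax_mul_sub_le hst hB hf fun j => hv j i
    have hsplit : ∑ j, alphat j * vt j i - ∑ j, hardmax s j * v j i =
        ∑ j, alphat j * (vt j i - v j i) + ∑ j, (alphat j - softmax st j) * v j i +
          ∑ j, softmax st j * (v j i - v m i) := by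
      rw [sum_hardmax_mul s (fun j => v j i) (v m i) hf]
      simp only [mul_sub, sub_mul, Finset.sum_sub_distrib]
      rw [← Finset.sum_mul Finset.univ (softmax st), sum_softmax]
      ring
    rw [hsplit, add_mul]
    refine (abs_add_three _ _ _).trans ?_
    linarith
end
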